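/- Quasi-orthogonality propagation (Lemma C.2). For every ℓ ∈ {0,…,L}, every positive integer k and all μ ≠ ν, there exists a constant C_k > 0 (depending only on k, ℓ and φ) such that E| X_μ^{(ℓ)}·X_ν^{(ℓ)} / d_ℓ |^k ≤ C_k / d_{[0:ℓ]}^{k/2}, where d_{[0:ℓ]} = min{d_0,…,d_ℓ}. -/

import Mathlib

open MeasureTheory ProbabilityTheory

noncomputable section

/-- Standard Gaussian measure on `ℝ`. -/
def stdG : Measure ℝ := gaussianReal 0 1

instance : IsProbabilityMeasure stdG := by unfold stdG; infer_instance

/-- Standard Gaussian measure on `Fin k → ℝ`. -/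
def stdGPi (k : ℕ) : Measure (Fin k → ℝ) := Measure.pi fun _ => stdG

instance (k : ℕ) : IsProbabilityMeasure (stdGPi k) := by unfold stdGPi; infer_instance

/-- The space of weights of an `L`-hidden-layer network with widths `d 0, …, d L`. -/
abbrev Wspace (d : ℕ → ℕ) (L : ℕ) :=
  (ℓ : Fin L) → Fin (d ((ℓ : ℕ) + 1)) → Fin (d (ℓ : ℕ)) → ℝ

/-- i.i.d. standard Gaussian measure on the weights. -/
def Wmeasure (d : ℕ → ℕ) (L : ℕ) : Measure (Wspace d L) :=
  Measure.pi fun ℓ => Measure.pi fun _ => stdGPi (d (ℓ : ℕ))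

instance (d : ℕ → ℕ) (L : ℕ) : IsProbabilityMeasure (Wmeasure d L) := by
  unfold Wmeasure; infer_instance

/-- Extension of a finite collection of weight matrices to all layer indices (by zero). -/
def extW {d : ℕ → ℕ} {L : ℕ} (W : Wspace d L) (ℓ : ℕ) : Fin (d (ℓ + 1)) → Fin (d ℓ) → ℝ :=
  if h : ℓ < L then W ⟨ℓ, h⟩ else 0

/-- Post-activations `X^{(ℓ)} = φ(W^{(ℓ)} X^{(ℓ-1)} / √d_{ℓ-1})`. -/
def feat (φ : ℝ → ℝ) (d : ℕ → ℕ) (W : (ℓ : ℕ) → Fin (d (ℓ + 1)) → Fin (d ℓ) → ℝ)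
    (x0 : Fin (d 0) → ℝ) : (ℓ : ℕ) → Fin (d ℓ) → ℝ
  | 0 => x0
  | (ℓ + 1) => fun i => φ ((∑ j, W ℓ i j * feat φ d W x0 ℓ j) / Real.sqrt (d ℓ : ℝ))

/-- Output kernel `P_out(y | x)`. -/
def Pout {p : ℕ} (PA : Measure (Fin p → ℝ)) (Δ : ℝ) (f : ℝ → (Fin p → ℝ) → ℝ)
    (y x : ℝ) : ℝ :=
  ∫ A, Real.exp (-(y - f x A) ^ 2 / (2 * Δ)) / Real.sqrt (2 * Real.pi * Δ) ∂PA

/-- The channel smeared with the extra Gaussian noise `√ε ξ`. -/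
def PoutEps {p : ℕ} (PA : Measure (Fin p → ℝ)) (Δ : ℝ) (f : ℝ → (Fin p → ℝ) → ℝ)
    (ε y s : ℝ) : ℝ :=
  ∫ ξ, Pout PA Δ f y (s + Real.sqrt ε * ξ) ∂stdG

/-- The coefficients `σ_ℓ`. -/
def sigmaC (φ : ℝ → ℝ) : ℕ → ℝ
  | 0 => 1
  | (ℓ + 1) => ∫ z, (φ (z * Real.sqrt (sigmaC φ ℓ))) ^ 2 ∂stdG

/-- The coefficients `ρ_ℓ` (meaningful for `ℓ ≥ 1`). -/
def rhoC (φ : ℝ → ℝ) (ℓ : ℕ) : ℝ :=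
  ∫ z, deriv φ (z * Real.sqrt (sigmaC φ (ℓ - 1))) ∂stdG

/-- The coefficients `ε_ℓ = σ_ℓ - σ_{ℓ-1} ρ_ℓ²` (meaningful for `ℓ ≥ 1`). -/
def epsC (φ : ℝ → ℝ) (ℓ : ℕ) : ℝ :=
  sigmaC φ ℓ - sigmaC φ (ℓ - 1) * (rhoC φ ℓ) ^ 2

/-- `d_m = min{d_0, …, d_L}`. -/
def dmin (d : ℕ → ℕ) (L : ℕ) : ℕ :=
  (Finset.range (L + 1)).inf' (Finset.nonempty_range_iff.mpr (Nat.succ_ne_zero L)) d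

/-- Linear readout of the `L`-layer network: `a⊤ X^{(L)} / √d_L`. -/
def netOut (φ : ℝ → ℝ) (d : ℕ → ℕ) (L : ℕ) (W : Wspace d L) (a : Fin (d L) → ℝ)
    (x0 : Fin (d 0) → ℝ) : ℝ :=
  (∑ i, a i * feat φ d (extW W) x0 L i) / Real.sqrt (d L : ℝ)

/-- Partition function (normalisation of the Bayes posterior) of the `L`-layer model. -/
def partFun (L p : ℕ) (PA : Measure (Fin p → ℝ)) [IsProbabilityMeasure PA]
    (Δ ρ ε : ℝ) (φ : ℝ → ℝ) (f : ℝ → (Fin p → ℝ) → ℝ) (d : ℕ → ℕ) (n : ℕ)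
    (X : Fin n → Fin (d 0) → ℝ) (Y : Fin n → ℝ) : ℝ :=
  ∫ θ : Wspace d L × (Fin (d L) → ℝ),
      ∏ μ, PoutEps PA Δ f ε (Y μ) (ρ * netOut φ d L θ.1 θ.2 (X μ))
    ∂((Wmeasure d L).prod (stdGPi (d L)))

/-- Space of all the quenched randomness of the `L`-layer teacher model:
inputs, teacher weights, readout, output noises `ξ*`, label noises `Z` and channel
randomness `A`. -/
abbrev Dspace (d : ℕ → ℕ) (L p n : ℕ) :=
  (Fin n → Fin (d 0) → ℝ) × Wspace d L × (Fin (d L) → ℝ) ×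
    (Fin n → ℝ) × (Fin n → ℝ) × (Fin n → Fin p → ℝ)

/-- Law of the quenched randomness. -/
def Dmeasure (d : ℕ → ℕ) (L p n : ℕ) (PA : Measure (Fin p → ℝ))
    [IsProbabilityMeasure PA] : Measure (Dspace d L p n) :=
  (Measure.pi fun _ : Fin n => stdGPi (d 0)).prod
    ((Wmeasure d L).prod ((stdGPi (d L)).prod
      ((stdGPi n).prod ((stdGPi n).prod (Measure.pi fun _ : Fin n => PA)))))

/-- Teacher pre-readout signal `S_μ = ρ a*⊤X_μ^{(L)}/√d_L + √ε ξ*_μ`. -/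
def Ssig (φ : ℝ → ℝ) (d : ℕ → ℕ) (L p n : ℕ) (ρ ε : ℝ) (ω : Dspace d L p n)
    (μi : Fin n) : ℝ :=
  ρ * netOut φ d L ω.2.1 ω.2.2.1 (ω.1 μi) + Real.sqrt ε * ω.2.2.2.1 μi

/-- Teacher responses `Y_μ = f(S_μ; A_μ) + √Δ Z_μ`. -/
def Yresp (φ : ℝ → ℝ) (f : ℝ → (Fin p → ℝ) → ℝ) (d : ℕ → ℕ) (L n : ℕ)
    (ρ ε Δ : ℝ) (ω : Dspace d L p n) (μi : Fin n) : ℝ :=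
  f (Ssig φ d L p n ρ ε ω μi) (ω.2.2.2.2.2 μi) + Real.sqrt Δ * ω.2.2.2.2.1 μi

/-- Mutual information per sample
`(1/n) I_n = E log P_out(Y_1|S_1) - (1/n) E log Z_L(D_L)`
(the first term is written as an average over samples, all equal by symmetry). -/
def MIper (L p : ℕ) (PA : Measure (Fin p → ℝ)) [IsProbabilityMeasure PA]
    (Δ ρ ε : ℝ) (φ : ℝ → ℝ) (f : ℝ → (Fin p → ℝ) → ℝ) (d : ℕ → ℕ) (n : ℕ) : ℝ :=
  (1 / (n : ℝ)) * ∑ μi : Fin n,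
      ∫ ω, Real.log (Pout PA Δ f (Yresp φ f d L n ρ ε Δ ω μi) (Ssig φ d L p n ρ ε ω μi))
        ∂(Dmeasure d L p n PA)
    - (1 / (n : ℝ)) *
      ∫ ω, Real.log (partFun L p PA Δ ρ ε φ f d n ω.1 (Yresp φ f d L n ρ ε Δ ω))
        ∂(Dmeasure d L p n PA)


section Moments

variable {E F : Type*} [MeasurableSpace E] [MeasurableSpace F]

/-- A real random variable all of whose absolute moments are finite. -/
def HasMoments (g : E → ℝ) (γ : Measure E) : Prop :=
  AEStronglyMeasurable g γ ∧ ∀ p : ℕ, Integrable (fun x => |g x| ^ p) γ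

namespace HasMoments

variable {γ : Measure E} {f g : E → ℝ}

lemma integrable_pow (hg : HasMoments g γ) (p : ℕ) : Integrable (fun x => g x ^ p) γ :=
  (hg.2 p).mono' (hg.1.pow p) (by simp)

lemma integrable (hg : HasMoments g γ) : Integrable g γ := by
  simpa using hg.integrable_pow 1

lemma const [IsFiniteMeasure γ] (c : ℝ) : HasMoments (fun _ => c) γ :=
  ⟨aestronglyMeasurable_const, fun _ => integrable_const _⟩

lemma mono (hf : HasMoments f γ) (hg : AEStronglyMeasurable g γ) (h : ∀ x, |g x| ≤ |f x|) :
    HasMoments g γ := by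
  refine ⟨hg, fun p => (hf.2 p).mono' (hg.norm.pow p) (ae_of_all _ fun x => ?_)⟩
  rw [Real.norm_eq_abs, abs_pow, abs_abs]
  exact pow_le_pow_left₀ (abs_nonneg _) (h x) p

lemma add (hf : HasMoments f γ) (hg : HasMoments g γ) : HasMoments (fun x => f x + g x) γ := by
  refine ⟨hf.1.add hg.1, fun p => (((hf.2 p).add (hg.2 p)).const_mul (2 ^ (p - 1))).mono'
    ((hf.1.add hg.1).norm.pow p) (ae_of_all _ fun x => ?_)⟩
  rw [Real.norm_eq_abs, abs_pow, abs_abs]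
  exact (pow_le_pow_left₀ (abs_nonneg _) (abs_add_le _ _) p).trans
    (add_pow_le (abs_nonneg _) (abs_nonneg _) p)

lemma mul (hf : HasMoments f γ) (hg : HasMoments g γ) : HasMoments (fun x => f x * g x) γ := by
  refine ⟨hf.1.mul hg.1, fun p => ((hf.2 (2 * p)).add (hg.2 (2 * p))).mono'
    ((hf.1.mul hg.1).norm.pow p) (ae_of_all _ fun x => ?_)⟩
  rw [Real.norm_eq_abs, abs_pow, abs_abs, abs_mul, mul_pow, Pi.add_apply]
  simp only [pow_mul']
  nlinarith [sq_nonneg (|f x| ^ p - |g x| ^ p), sq_nonneg (|f x| ^ p), sq_nonneg (|g x| ^ p)]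

lemma sum [IsFiniteMeasure γ] {ι : Type*} {s : Finset ι} {f : ι → E → ℝ}
    (h : ∀ i ∈ s, HasMoments (f i) γ) : HasMoments (fun x => ∑ i ∈ s, f i x) γ := by
  classical
  induction s using Finset.induction_on with
  | empty => simpa using const (γ := γ) 0
  | insert a s ha ih =>
    simp only [Finset.sum_insert ha]
    exact (h a (Finset.mem_insert_self _ _)).add
      (ih fun i hi => h i (Finset.mem_insert_of_mem hi))

lemma comp {δ : Measure F} {T : F → E} (hg : HasMoments g γ) (hT : MeasurePreserving T δ γ) :
    HasMoments (fun x => g (T x)) δ :=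
  ⟨hg.1.comp_measurePreserving hT, fun p => hT.integrable_comp_of_integrable (hg.2 p)⟩

end HasMoments

end Moments

lemma abs_add_pow_sub_le (n : ℕ) (s x : ℝ) :
    |(s + x) ^ (n + 2) - s ^ (n + 2) - (n + 2) * s ^ (n + 1) * x| ≤
      (n + 2) ^ 2 * x ^ 2 * (|s| + |x|) ^ n := by
  induction n with
  | zero =>
    have : (s + x) ^ (0 + 2) - s ^ (0 + 2) - ((0 : ℕ) + 2) * s ^ (0 + 1) * x = x ^ 2 := by
      push_cast; ring
    rw [this, abs_of_nonneg (sq_nonneg x)]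
    push_cast
    nlinarith [sq_nonneg x]
  | succ n ih =>
    have e : (s + x) ^ (n + 1 + 2) - s ^ (n + 1 + 2) - ((n + 1 : ℕ) + 2) * s ^ (n + 1 + 1) * x
        = (s + x) * ((s + x) ^ (n + 2) - s ^ (n + 2) - (n + 2) * s ^ (n + 1) * x)
          + (n + 2) * (s ^ (n + 1) * x ^ 2) := by
      push_cast; ring
    have hs : |s| ≤ |s| + |x| := by linarith [abs_nonneg x]
    have h1 : |s ^ (n + 1) * x ^ 2| ≤ (|s| + |x|) ^ (n + 1) * x ^ 2 := by
      rw [abs_mul, abs_pow, abs_of_nonneg (sq_nonneg x)]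
      gcongr
    rw [e]
    calc _ ≤ |s + x| * |(s + x) ^ (n + 2) - s ^ (n + 2) - (n + 2) * s ^ (n + 1) * x|
          + (n + 2) * |s ^ (n + 1) * x ^ 2| := by
            refine (abs_add_le _ _).trans ?_
            rw [abs_mul, abs_mul, abs_of_nonneg (by positivity : (0 : ℝ) ≤ n + 2)]
      _ ≤ (|s| + |x|) * ((n + 2) ^ 2 * x ^ 2 * (|s| + |x|) ^ n)
          + (n + 2) * ((|s| + |x|) ^ (n + 1) * x ^ 2) := by
            gcongr
            exact abs_add_le _ _
      _ = ((n + 2) ^ 2 + (n + 2)) * x ^ 2 * (|s| + |x|) ^ (n + 1) := by ring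
      _ ≤ _ := by
            push_cast
            gcongr
            nlinarith [(Nat.cast_nonneg n : (0 : ℝ) ≤ n)]

lemma add_pow_two_mul_le (a b : ℝ) (p : ℕ) :
    (a + b) ^ (2 * p) ≤ 2 ^ (2 * p) * (a ^ (2 * p) + b ^ (2 * p)) := by
  have h1 := add_pow_le (abs_nonneg a) (abs_nonneg b) (2 * p)
  have h2 := pow_le_pow_left₀ (abs_nonneg _) (abs_add_le a b) (2 * p)
  simp only [(even_two_mul p).pow_abs] at h1 h2
  refine h2.trans (h1.trans (mul_le_mul_of_nonneg_right ?_ ?_))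
  · exact pow_le_pow_right₀ (by norm_num) (Nat.sub_le _ _)
  · exact add_nonneg ((even_two_mul p).pow_nonneg _) ((even_two_mul p).pow_nonneg _)

lemma add_pow_even_le (p : ℕ) (s x : ℝ) :
    (x + s) ^ (2 * (p + 1)) ≤ s ^ (2 * (p + 1)) + (2 * p + 2) * (x * s ^ (2 * p + 1)) +
      (2 * p + 2) ^ 2 * 2 ^ (2 * p) * (x ^ 2 * s ^ (2 * p) + x ^ (2 * (p + 1))) := by
  have h := (le_abs_self _).trans (abs_add_pow_sub_le (2 * p) s x)
  have h2 := add_pow_two_mul_le |s| |x| p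
  rw [(even_two_mul p).pow_abs, (even_two_mul p).pow_abs] at h2
  have h4 : ((2 * p : ℕ) + 2 : ℝ) ^ 2 * x ^ 2 * (|s| + |x|) ^ (2 * p) ≤
      ((2 * p : ℕ) + 2 : ℝ) ^ 2 * x ^ 2 * (2 ^ (2 * p) * (s ^ (2 * p) + x ^ (2 * p))) := by
    gcongr
  have e : 2 * (p + 1) = 2 * p + 2 := by ring
  rw [e, add_comm x s]
  push_cast at h h4
  have e2 : x ^ (2 * p + 2) = x ^ 2 * x ^ (2 * p) := by ring
  rw [e2]
  linarith

/-- Even moments of a sum of `n` centred i.i.d. variables grow at most like `n ^ p`. -/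
lemma exists_moment_sum_le (M : ℕ → ℝ) (hM : ∀ j, 0 ≤ M j) (p : ℕ) :
    ∃ C : ℝ, 0 ≤ C ∧ ∀ (E : Type) [MeasurableSpace E] (γ : Measure E) [IsProbabilityMeasure γ]
      (g : E → ℝ) (B : ℝ), HasMoments g γ → ∫ x, g x ∂γ = 0 →
      (∀ j, ∫ x, g x ^ (2 * j) ∂γ ≤ M j * B ^ (2 * j)) → ∀ n : ℕ,
      ∫ w, (∑ i, g (w i)) ^ (2 * p) ∂(Measure.pi fun _ : Fin n => γ) ≤
        C * n ^ p * B ^ (2 * p) := by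
  induction p with
  | zero => exact ⟨1, zero_le_one, fun E _ γ _ g B _ _ _ n => by simp⟩
  | succ p ih =>
    obtain ⟨C₀, hC₀, hC⟩ := ih
    set c : ℝ := (2 * p + 2) ^ 2 * 2 ^ (2 * p) with hc
    have hc0 : 0 ≤ c := by positivity
    set C : ℝ := c * (M 1 * C₀ + M (p + 1)) with hCdef
    have hC0 : 0 ≤ C := mul_nonneg hc0 (add_nonneg (mul_nonneg (hM _) hC₀) (hM _))
    refine ⟨C, hC0, fun E _ γ _ g B hg hg0 hgM n => ?_⟩
    induction n with
    | zero => simp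
    | succ n ihn =>
      set S : (Fin n → E) → ℝ := fun w => ∑ i, g (w i) with hS
      set π := Measure.pi fun _ : Fin n => γ with hπ
      have hSm : HasMoments S π :=
        HasMoments.sum fun i _ => hg.comp (measurePreserving_eval (fun _ : Fin n => γ) i)
      have hmp := measurePreserving_piFinSuccAbove (fun _ : Fin (n + 1) => γ) 0
      have hB : ∀ j, 0 ≤ B ^ (2 * j) := fun j => (even_two_mul j).pow_nonneg B
      have e1 : ∫ w, (∑ i, g (w i)) ^ (2 * (p + 1)) ∂(Measure.pi fun _ : Fin (n + 1) => γ) =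
          ∫ z : E × (Fin n → E), (g z.1 + S z.2) ^ (2 * (p + 1)) ∂(γ.prod π) := by
        rw [← hmp.integral_comp']
        refine integral_congr_ae (ae_of_all _ fun w => ?_)
        simp [hS, Fin.sum_univ_succ, Fin.tail]
      have i1 : Integrable (fun z : E × (Fin n → E) => S z.2 ^ (2 * (p + 1))) (γ.prod π) :=
        (hSm.integrable_pow _).comp_snd γ
      have i2 : Integrable (fun z : E × (Fin n → E) => g z.1 * S z.2 ^ (2 * p + 1)) (γ.prod π) :=
        hg.integrable.mul_prod (hSm.integrable_pow _)
      have i3 : Integrable (fun z : E × (Fin n → E) => g z.1 ^ 2 * S z.2 ^ (2 * p)) (γ.prod π) :=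
        (hg.integrable_pow 2).mul_prod (hSm.integrable_pow _)
      have i4 : Integrable (fun z : E × (Fin n → E) => g z.1 ^ (2 * (p + 1))) (γ.prod π) :=
        (hg.integrable_pow _).comp_fst π
      have e2 : ∫ z : E × (Fin n → E), (g z.1 + S z.2) ^ (2 * (p + 1)) ∂(γ.prod π) ≤
          ∫ w, S w ^ (2 * (p + 1)) ∂π + c * ((∫ x, g x ^ 2 ∂γ) * (∫ w, S w ^ (2 * p) ∂π)
            + ∫ x, g x ^ (2 * (p + 1)) ∂γ) := by
        have hle := integral_mono (((hg.comp measurePreserving_fst).add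
          (hSm.comp measurePreserving_snd)).integrable_pow (2 * (p + 1)))
          ((i1.add (i2.const_mul (2 * p + 2))).add ((i3.add i4).const_mul c))
          (fun z => add_pow_even_le p (S z.2) (g z.1))
        refine hle.trans_eq ?_
        rw [integral_add' (i1.add (i2.const_mul _)) ((i3.add i4).const_mul c),
          integral_add' i1 (i2.const_mul _), integral_const_mul, integral_const_mul]
        simp only [Pi.add_apply]
        rw [integral_add i3 i4, integral_prod_mul g (fun w => S w ^ (2 * p + 1)),
          integral_prod_mul (fun x => g x ^ 2) (fun w => S w ^ (2 * p)), hg0,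
          integral_fun_snd (fun w => S w ^ (2 * (p + 1))),
          integral_fun_fst (fun x => g x ^ (2 * (p + 1)))]
        simp
      have hn : (0 : ℝ) ≤ n := Nat.cast_nonneg n
      have hg2 : ∫ x, g x ^ 2 ∂γ ≤ M 1 * B ^ 2 := by simpa using hgM 1
      have hS0 : 0 ≤ ∫ w, S w ^ (2 * p) ∂π :=
        integral_nonneg fun w => (even_two_mul p).pow_nonneg _
      have hp1 : (n : ℝ) ^ p ≤ (n + 1) ^ p := by gcongr; linarith
      have hp2 : (1 : ℝ) ≤ (n + 1) ^ p := one_le_pow₀ (by linarith)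
      rw [e1]
      calc _ ≤ _ := e2
        _ ≤ C * n ^ (p + 1) * B ^ (2 * (p + 1)) + c * ((M 1 * B ^ 2) * (C₀ * n ^ p * B ^ (2 * p))
            + M (p + 1) * B ^ (2 * (p + 1))) := by
          have h1 := hC E γ g B hg hg0 hgM n
          have h2 := hgM (p + 1)
          have h3 : (∫ x, g x ^ 2 ∂γ) * (∫ w, S w ^ (2 * p) ∂π) ≤
              (M 1 * B ^ 2) * (C₀ * n ^ p * B ^ (2 * p)) :=
            mul_le_mul hg2 h1 hS0 (mul_nonneg (hM 1) (sq_nonneg B))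
          gcongr
        _ = (C * n ^ (p + 1) + c * (M 1 * C₀ * n ^ p + M (p + 1) * 1)) * B ^ (2 * (p + 1)) := by
          ring
        _ ≤ (C * (n * (n + 1) ^ p) +
              c * (M 1 * C₀ * (n + 1) ^ p + M (p + 1) * (n + 1) ^ p)) * B ^ (2 * (p + 1)) := by
          have := hM 1
          have := hM (p + 1)
          have h5 : (n : ℝ) ^ (p + 1) ≤ n * (n + 1) ^ p := by
            rw [pow_succ']; gcongr
          have := hB (p + 1)
          gcongr
        _ = _ := by
          rw [hCdef]; push_cast; ring

lemma lintegral_pi_update {ι : Type*} [Fintype ι] [DecidableEq ι] {X : ι → Type*}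
    [∀ i, MeasurableSpace (X i)] (μ : ∀ i, Measure (X i)) [∀ i, IsProbabilityMeasure (μ i)]
    (i : ι) {f : (∀ i, X i) → ENNReal} (hf : Measurable f) :
    ∫⁻ x, f x ∂Measure.pi μ =
      ∫⁻ x, ∫⁻ y, f (Function.update x i y) ∂μ i ∂Measure.pi μ := by
  have hG : Measurable fun x : ∀ i, X i => ∫⁻ y, f (Function.update x i y) ∂μ i := by
    have h : Measurable fun z : (∀ i, X i) × X i => f (Function.update z.1 i z.2) :=
      hf.comp measurable_update'
    exact h.lintegral_prod_right'
  have h1 := lmarginal_erase' (μ := μ) f hf (Finset.mem_univ i)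
  have h2 := lmarginal_erase' (μ := μ) _ hG (Finset.mem_univ i)
  simp only [Function.update_idem, lintegral_const, measure_univ, mul_one] at h2
  rw [lmarginal_univ] at h1 h2
  have : ∀ i, Nonempty (X i) := fun i => (μ i).nonempty_of_neZero
  have x₀ : ∀ i, X i := fun i => Classical.arbitrary _
  exact (congrFun h1 x₀).trans (congrFun h2 x₀).symm

/-- The moments of the standard Gaussian distribution. -/
def gaussianMoment (j : ℕ) : ℝ := ∫ z, z ^ j ∂stdG

lemma gaussianMoment_even_nonneg (j : ℕ) : 0 ≤ gaussianMoment (2 * j) :=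
  integral_nonneg fun z => (even_two_mul j).pow_nonneg z

lemma hasMoments_stdG : HasMoments (fun z => z) stdG :=
  ⟨by fun_prop, fun p =>
    ((memLp_id_gaussianReal' (p : ENNReal) (by simp)).integrable_norm_pow')⟩

lemma measurePreserving_toLp (d : ℕ) :
    MeasurePreserving (MeasurableEquiv.toLp 2 (Fin d → ℝ)) (stdGPi d)
      (stdGaussian (EuclideanSpace ℝ (Fin d))) :=
  ⟨(MeasurableEquiv.toLp 2 (Fin d → ℝ)).measurable, map_pi_eq_stdGaussian⟩

lemma inner_toLp {d : ℕ} (u w : Fin d → ℝ) :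
    inner ℝ (WithLp.toLp 2 u : EuclideanSpace ℝ (Fin d)) (WithLp.toLp 2 w) = ∑ j, w j * u j := by
  simp [PiLp.inner_apply]

lemma map_dot_stdGPi {d : ℕ} (u : Fin d → ℝ) :
    (stdGPi d).map (fun w => ∑ j, w j * u j) =
      stdG.map (fun z => Real.sqrt (∑ j, u j ^ 2) * z) := by
  set U : EuclideanSpace ℝ (Fin d) := WithLp.toLp 2 u with hU
  have e : (fun w : Fin d → ℝ => ∑ j, w j * u j) =
      (innerSL ℝ U) ∘ (MeasurableEquiv.toLp 2 (Fin d → ℝ)) := by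
    funext w
    exact (inner_toLp u w).symm
  have hn : ‖U‖ ^ 2 = ∑ j, u j ^ 2 := by
    simp [hU, EuclideanSpace.real_norm_sq_eq]
  rw [e, ← Measure.map_map (by fun_prop) (by fun_prop), (measurePreserving_toLp d).map_eq,
    IsGaussian.map_eq_gaussianReal, integral_strongDual_stdGaussian, variance_dual_stdGaussian,
    innerSL_apply_norm, hn, stdG, gaussianReal_map_const_mul]
  congr 1
  · simp
  · ext
    simp [Real.sq_sqrt (Finset.sum_nonneg fun j _ => sq_nonneg (u j)),
      Finset.sum_nonneg fun j _ => sq_nonneg (u j)]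

lemma hasMoments_dot {d : ℕ} (u : Fin d → ℝ) :
    HasMoments (fun w => ∑ j, w j * u j) (stdGPi d) :=
  HasMoments.sum fun j _ =>
    (hasMoments_stdG.comp (measurePreserving_eval (fun _ : Fin d => stdG) j)).mul
      (HasMoments.const (u j))

lemma integral_dot_pow {d : ℕ} (u : Fin d → ℝ) (p : ℕ) :
    ∫ w, (∑ j, w j * u j) ^ (2 * p) ∂(stdGPi d) =
      (∑ j, u j ^ 2) ^ p * gaussianMoment (2 * p) := by
  have h1 := integral_map (μ := stdGPi d) (φ := fun w => ∑ j, w j * u j)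
    (f := fun z => z ^ (2 * p)) (Measurable.aemeasurable (by fun_prop)) (by fun_prop)
  have h2 := integral_map (μ := stdG) (φ := fun z => Real.sqrt (∑ j, u j ^ 2) * z)
    (f := fun z => z ^ (2 * p)) (by fun_prop) (by fun_prop)
  rw [← h1, map_dot_stdGPi, h2]
  simp_rw [mul_pow]
  rw [integral_const_mul, pow_mul, Real.sq_sqrt (Finset.sum_nonneg fun j _ => sq_nonneg (u j)),
    gaussianMoment]

/-- Correlation bound for an odd Lipschitz function of two jointly Gaussian variables. -/
lemma abs_integral_odd_mul_le {φ : ℝ → ℝ} {K : ℝ} (hK : 0 ≤ K)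
    (hφ : ∀ x y, |φ x - φ y| ≤ K * |x - y|) (hodd : ∀ x, φ (-x) = -φ x) {d : ℕ}
    (u v : Fin d → ℝ) :
    |∫ w, φ (∑ j, w j * u j) * φ (∑ j, w j * v j) ∂(stdGPi d)| ≤ K ^ 2 * |∑ j, u j * v j| := by
  have hφ0 : φ 0 = 0 := by have := hodd 0; simp at this; linarith
  have hφ1 : ∀ x, |φ x| ≤ K * |x| := fun x => by simpa [hφ0] using hφ x 0
  have hφc : Continuous φ := by
    have : LipschitzWith K.toNNReal φ := LipschitzWith.of_dist_le_mul fun x y => by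
      simpa [Real.dist_eq, Real.coe_toNNReal K hK] using hφ x y
    exact this.continuous
  set U : EuclideanSpace ℝ (Fin d) := WithLp.toLp 2 u with hU
  set V : EuclideanSpace ℝ (Fin d) := WithLp.toLp 2 v with hV
  set R := (ℝ ∙ U).reflection with hR
  set c : ℝ := inner ℝ U V / ‖U‖ ^ 2 with hc
  set γ := stdGaussian (EuclideanSpace ℝ (Fin d)) with hγ
  have hRU : R U = U := Submodule.reflection_mem_subspace_eq_self
    (Submodule.mem_span_singleton_self U)
  have hRV : R V = (2 * c) • U - V := by
    rw [hR, Submodule.reflection_singleton_apply, mul_smul, two_smul ℝ, two_smul ℕ]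
    rfl
  have hRR : ∀ w a, inner ℝ a (R w) = inner ℝ (R a) w := fun w a => by
    rw [← R.inner_map_map a (R w), hR, Submodule.reflection_reflection]
  have hmu : ∀ a : EuclideanSpace ℝ (Fin d), HasMoments (fun w => inner ℝ a w) γ := fun a => by
    have h := (hasMoments_dot (WithLp.ofLp a)).comp (measurePreserving_toLp d).symm
    refine (funext fun w => ?_ : (fun w => inner ℝ a w) = _) ▸ h
    exact inner_toLp (WithLp.ofLp a) (WithLp.ofLp w)
  have hφm : ∀ a : EuclideanSpace ℝ (Fin d), HasMoments (fun w => φ (inner ℝ a w)) γ := fun a =>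
    (((HasMoments.const K).mul (hmu a))).mono (by fun_prop) fun w => by
      rw [abs_mul, abs_of_nonneg hK]; exact hφ1 _
  set f : EuclideanSpace ℝ (Fin d) → ℝ := fun w => φ (inner ℝ U w) * φ (inner ℝ V w) with hf
  have hfi : Integrable f γ := ((hφm U).mul (hφm V)).integrable
  have hRmp : MeasurePreserving R γ γ := ⟨R.continuous.measurable, stdGaussian_map R⟩
  have hfR : ∫ w, f (R w) ∂γ = ∫ w, f w ∂γ :=
    hRmp.integral_comp R.toHomeomorph.measurableEmbedding f
  have e0 : ∫ w, φ (∑ j, w j * u j) * φ (∑ j, w j * v j) ∂(stdGPi d) = ∫ w, f w ∂γ := by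
    rw [← (measurePreserving_toLp d).integral_comp' f]
    refine integral_congr_ae (ae_of_all _ fun w => ?_)
    simp only [hf, ← inner_toLp]
    rfl
  have hpt : ∀ w, |f w + f (R w)| ≤ 2 * K ^ 2 * |c| * (inner ℝ U w) ^ 2 := fun w => by
    have h1 : f w + f (R w) =
        φ (inner ℝ U w) * (φ (inner ℝ V w) - φ (inner ℝ V w - 2 * c * inner ℝ U w)) := by
      simp only [hf, hRR, hRU, hRV, inner_sub_left, real_inner_smul_left]
      rw [← neg_sub (inner ℝ V w), hodd]
      ring
    rw [h1, abs_mul]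
    calc _ ≤ (K * |inner ℝ U w|) * (K * |2 * c * inner ℝ U w|) := by
          gcongr
          · exact hφ1 _
          · simpa using hφ (inner ℝ V w) (inner ℝ V w - 2 * c * inner ℝ U w)
      _ = _ := by
          rw [abs_mul, abs_mul, abs_two, ← sq_abs (inner ℝ U w)]
          ring
  have hsq : ∫ w, (inner ℝ U w) ^ 2 ∂γ = ‖U‖ ^ 2 := by
    have h := variance_dual_stdGaussian (innerSL ℝ U)
    rw [variance_of_integral_eq_zero (by fun_prop) (integral_strongDual_stdGaussian _),
      innerSL_apply_norm] at h
    exact h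
  have hcn : |c| * ‖U‖ ^ 2 = |inner ℝ U V| := by
    rcases eq_or_ne U 0 with h | h
    · simp [h]
    · rw [hc, abs_div, abs_of_nonneg (sq_nonneg ‖U‖)]
      field_simp
  have hfin : |∫ w, (f w + f (R w)) ∂γ| ≤ 2 * K ^ 2 * |c| * ‖U‖ ^ 2 := by
    rw [← hsq, ← integral_const_mul]
    exact abs_integral_le_integral_abs.trans (integral_mono_of_nonneg
      (ae_of_all _ fun _ => abs_nonneg _) (((hmu U).integrable_pow 2).const_mul _)
      (ae_of_all _ hpt))
  have hfRi : Integrable (fun w => f (R w)) γ := hRmp.integrable_comp_of_integrable hfi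
  rw [integral_add hfi hfRi, hfR, ← two_mul, abs_mul,
    abs_two, mul_assoc, hcn] at hfin
  have hin : (inner ℝ U V : ℝ) = ∑ j, u j * v j := by
    rw [hU, hV, inner_toLp]
    simp_rw [mul_comm]
  rw [e0, ← hin]
  linarith

/-- The normalized scalar product of two vectors. -/
def overlap {n : ℕ} (x y : Fin n → ℝ) : ℝ := (∑ i, x i * y i) / n

/-- One layer of the network. -/
def layer (φ : ℝ → ℝ) {m d : ℕ} (W : Fin m → Fin d → ℝ) (x : Fin d → ℝ) : Fin m → ℝ :=
  fun i => φ ((∑ j, W i j * x j) / Real.sqrt d)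

lemma feat_succ (φ : ℝ → ℝ) (d : ℕ → ℕ) (W : (ℓ : ℕ) → Fin (d (ℓ + 1)) → Fin (d ℓ) → ℝ)
    (x0 : Fin (d 0) → ℝ) (ℓ : ℕ) : feat φ d W x0 (ℓ + 1) = layer φ (W ℓ) (feat φ d W x0 ℓ) :=
  rfl

lemma overlap_self_nonneg {n : ℕ} (x : Fin n → ℝ) : 0 ≤ overlap x x :=
  div_nonneg (Finset.sum_nonneg fun i _ => mul_self_nonneg (x i)) (Nat.cast_nonneg n)

lemma abs_overlap_le {n : ℕ} (x y : Fin n → ℝ) :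
    |overlap x y| ≤ overlap x x + overlap y y := by
  rw [overlap, overlap, overlap, ← add_div, abs_div, Nat.abs_cast, ← Finset.sum_add_distrib]
  gcongr
  refine (Finset.abs_sum_le_sum_abs _ _).trans (Finset.sum_le_sum fun i _ => ?_)
  rw [abs_le]
  constructor <;> nlinarith [sq_nonneg (x i - y i), sq_nonneg (x i + y i), sq_nonneg (x i),
    sq_nonneg (y i)]

/-- Conditionally on the previous layer, the even moments of the overlap of two post-activations
are controlled by the overlaps of the previous layer. -/
lemma exists_layer_overlap_le {φ : ℝ → ℝ} {K : ℝ} (hK : 0 ≤ K)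
    (hφ : ∀ x y, |φ x - φ y| ≤ K * |x - y|) (hodd : ∀ x, φ (-x) = -φ x) (k : ℕ) :
    ∃ C : ℝ, 0 ≤ C ∧ ∀ (d m : ℕ), 1 ≤ m → ∀ x y : Fin d → ℝ,
      ∫⁻ W, ENNReal.ofReal (overlap (layer φ W x) (layer φ W y) ^ (2 * k))
          ∂(Measure.pi fun _ : Fin m => stdGPi d) ≤
        ENNReal.ofReal (C * (overlap x y ^ (2 * k) +
          (overlap x x ^ (2 * k) + overlap y y ^ (2 * k)) / m ^ k)) := by
  have hφ0 : φ 0 = 0 := by have := hodd 0; simp at this; linarith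
  have hφ1 : ∀ x, |φ x| ≤ K * |x| := fun x => by simpa [hφ0] using hφ x 0
  have hφc : Continuous φ := by
    have : LipschitzWith K.toNNReal φ := LipschitzWith.of_dist_le_mul fun x y => by
      simpa [Real.dist_eq, Real.coe_toNNReal K hK] using hφ x y
    exact this.continuous
  set M : ℕ → ℝ := fun j =>
    2 ^ (2 * j) * ((K ^ 2) ^ (2 * j) * (2 * gaussianMoment (2 * (2 * j))) + (K ^ 2) ^ (2 * j))
    with hMdef
  have hM : ∀ j, 0 ≤ M j := fun j => by
    have := gaussianMoment_even_nonneg (2 * j)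
    positivity
  obtain ⟨C, hC, hCb⟩ := exists_moment_sum_le M hM k
  refine ⟨2 ^ (2 * k) * (C * 2 ^ (2 * k) + (K ^ 2) ^ (2 * k)), by positivity,
    fun d m hm x y => ?_⟩
  set u : Fin d → ℝ := fun j => x j / Real.sqrt d with hu
  set v : Fin d → ℝ := fun j => y j / Real.sqrt d with hv
  have hdot : ∀ a b : Fin d → ℝ,
      ∑ j, a j / Real.sqrt d * (b j / Real.sqrt d) = overlap a b := fun a b => by
    rw [overlap, Finset.sum_div]
    refine Finset.sum_congr rfl fun j _ => ?_
    rw [div_mul_div_comm, Real.mul_self_sqrt (Nat.cast_nonneg d)]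
  have hlay : ∀ (W : Fin m → Fin d → ℝ) (a : Fin d → ℝ) (i : Fin m),
      layer φ W a i = φ (∑ j, W i j * (a j / Real.sqrt d)) := fun W a i => by
    simp only [layer, Finset.sum_div, mul_div_assoc]
  have hsq : ∀ a : Fin d → ℝ, ∑ j, (a j / Real.sqrt d) ^ 2 = overlap a a := fun a => by
    rw [← hdot]
    simp_rw [sq]
  set a := overlap x x with ha
  set b := overlap y y with hb
  set q := overlap x y with hq
  have ha0 : 0 ≤ a := overlap_self_nonneg x
  have hb0 : 0 ≤ b := overlap_self_nonneg y
  have hqab : |q| ≤ a + b := abs_overlap_le x y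
  have hφm : ∀ t : Fin d → ℝ, HasMoments (fun w => φ (∑ j, w j * t j)) (stdGPi d) := fun t =>
    ((HasMoments.const K).mul (hasMoments_dot t)).mono
      (Measurable.aestronglyMeasurable (by fun_prop)) fun w => by
        rw [abs_mul, abs_of_nonneg hK]; exact hφ1 _
  set f : (Fin d → ℝ) → ℝ := fun w => φ (∑ j, w j * u j) * φ (∑ j, w j * v j) with hf
  have hfm : HasMoments f (stdGPi d) := (hφm u).mul (hφm v)
  set r := ∫ w, f w ∂(stdGPi d) with hr
  have hrq : |r| ≤ K ^ 2 * |q| := by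
    have := abs_integral_odd_mul_le hK hφ hodd u v
    rwa [hu, hv, hdot] at this
  set g : (Fin d → ℝ) → ℝ := fun w => f w + -r with hg
  have hgm : HasMoments g (stdGPi d) := hfm.add (HasMoments.const (-r))
  have hg0 : ∫ w, g w ∂(stdGPi d) = 0 := by
    rw [hg, integral_add hfm.integrable (integrable_const _)]
    simp [hr]
  have heven : ∀ (s : ℝ) (j : ℕ), 0 ≤ s ^ (2 * j) := fun s j => (even_two_mul j).pow_nonneg s
  have habs : ∀ {s t : ℝ} (j : ℕ), |s| ≤ t → s ^ (2 * j) ≤ t ^ (2 * j) := fun {s t} j h => by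
    rw [← (even_two_mul j).pow_abs s]
    exact pow_le_pow_left₀ (abs_nonneg _) h _
  have hgM : ∀ j, ∫ w, g w ^ (2 * j) ∂(stdGPi d) ≤ M j * (a + b) ^ (2 * j) := fun j => by
    have hpt : ∀ w, g w ^ (2 * j) ≤ 2 ^ (2 * j) * ((K ^ 2) ^ (2 * j) *
        ((∑ i, w i * u i) ^ (2 * (2 * j)) + (∑ i, w i * v i) ^ (2 * (2 * j))) +
          (K ^ 2) ^ (2 * j) * (a + b) ^ (2 * j)) := fun w => by
      refine (add_pow_two_mul_le _ _ j).trans ?_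
      have h1 : (-r) ^ (2 * j) ≤ (K ^ 2) ^ (2 * j) * (a + b) ^ (2 * j) := by
        rw [← mul_pow]
        refine habs j ((abs_neg r).trans_le (hrq.trans ?_))
        gcongr
      have h2 : f w ^ (2 * j) ≤ (K ^ 2) ^ (2 * j) *
          ((∑ i, w i * u i) ^ (2 * (2 * j)) + (∑ i, w i * v i) ^ (2 * (2 * j))) := by
        have h3 : |f w| ≤ K ^ 2 * (|∑ i, w i * u i| * |∑ i, w i * v i|) := by
          rw [hf, abs_mul]
          calc _ ≤ (K * |∑ i, w i * u i|) * (K * |∑ i, w i * v i|) := by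
                gcongr <;> exact hφ1 _
            _ = _ := by ring
        refine (habs j h3).trans ?_
        rw [mul_pow, mul_pow, (even_two_mul j).pow_abs, (even_two_mul j).pow_abs]
        gcongr
        rw [pow_mul' _ 2 (2 * j), pow_mul' _ 2 (2 * j)]
        nlinarith [sq_nonneg ((∑ i, w i * u i) ^ (2 * j) - (∑ i, w i * v i) ^ (2 * j)),
          sq_nonneg ((∑ i, w i * u i) ^ (2 * j)), sq_nonneg ((∑ i, w i * v i) ^ (2 * j))]
      gcongr
    have i1 := (hasMoments_dot u).integrable_pow (2 * (2 * j))
    have i2 := (hasMoments_dot v).integrable_pow (2 * (2 * j))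
    have i3 := (i1.add i2).const_mul ((K ^ 2) ^ (2 * j))
    have hle := integral_mono (hgm.integrable_pow (2 * j))
      ((i3.add (integrable_const _)).const_mul _) hpt
    refine hle.trans ?_
    rw [integral_const_mul, integral_add' i3 (integrable_const _), integral_const_mul]
    simp only [Pi.add_apply]
    rw [integral_add i1 i2, integral_dot_pow, integral_dot_pow, hsq, hsq, ← ha, ← hb]
    have hA : a ^ (2 * j) ≤ (a + b) ^ (2 * j) := by gcongr; linarith
    have hB : b ^ (2 * j) ≤ (a + b) ^ (2 * j) := by gcongr; linarith
    have hG := gaussianMoment_even_nonneg (2 * j)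
    calc _ ≤ 2 ^ (2 * j) * ((K ^ 2) ^ (2 * j) *
          ((a + b) ^ (2 * j) * gaussianMoment (2 * (2 * j)) +
            (a + b) ^ (2 * j) * gaussianMoment (2 * (2 * j))) +
          (K ^ 2) ^ (2 * j) * (a + b) ^ (2 * j)) := by
          simp only [integral_const, probReal_univ, one_smul]
          gcongr
      _ = _ := by rw [hMdef]; ring
  set π := Measure.pi fun _ : Fin m => stdGPi d with hπ
  set S : (Fin m → Fin d → ℝ) → ℝ := fun W => ∑ i, g (W i) with hS
  have hSm : HasMoments S π :=
    HasMoments.sum fun i _ => hgm.comp (measurePreserving_eval (fun _ : Fin m => stdGPi d) i)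
  have hSb := hCb (Fin d → ℝ) (stdGPi d) g (a + b) hgm hg0 hgM m
  have hm0 : (0 : ℝ) < m := by exact_mod_cast hm
  have hov : ∀ W : Fin m → Fin d → ℝ, overlap (layer φ W x) (layer φ W y) = S W / m + r :=
    fun W => by
      simp only [overlap, hlay, hS, hg, Finset.sum_add_distrib]
      simp only [hf, hu, hv, Finset.sum_const, Finset.card_univ, Fintype.card_fin, nsmul_eq_mul]
      field_simp
      ring
  have iS : Integrable (fun W => (S W / m) ^ (2 * k)) π := by
    simp_rw [div_pow]
    exact (hSm.integrable_pow _).div_const _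
  have iB : Integrable (fun W => 2 ^ (2 * k) * ((S W / m) ^ (2 * k) + r ^ (2 * k))) π :=
    (iS.add (integrable_const _)).const_mul _
  calc _ ≤ ∫⁻ W, ENNReal.ofReal (2 ^ (2 * k) * ((S W / m) ^ (2 * k) + r ^ (2 * k))) ∂π :=
        lintegral_mono fun W => ENNReal.ofReal_le_ofReal
          (by rw [hov]; exact add_pow_two_mul_le _ _ k)
    _ = ENNReal.ofReal (∫ W, 2 ^ (2 * k) * ((S W / m) ^ (2 * k) + r ^ (2 * k)) ∂π) :=
        (ofReal_integral_eq_lintegral_ofReal iB (ae_of_all _ fun W =>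
          mul_nonneg (by positivity) (add_nonneg (heven _ _) (heven _ _)))).symm
    _ ≤ _ := by
      refine ENNReal.ofReal_le_ofReal ?_
      rw [integral_const_mul, integral_add iS (integrable_const _)]
      simp_rw [div_pow]
      rw [integral_div, integral_const, probReal_univ, one_smul]
      have h1 : (∫ W, S W ^ (2 * k) ∂π) / (m : ℝ) ^ (2 * k) ≤
          C * 2 ^ (2 * k) * ((a ^ (2 * k) + b ^ (2 * k)) / m ^ k) := by
        rw [div_le_iff₀ (by positivity)]
        refine hSb.trans ?_
        calc _ ≤ C * m ^ k * (2 ^ (2 * k) * (a ^ (2 * k) + b ^ (2 * k))) := by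
              gcongr
              exact add_pow_two_mul_le a b k
          _ = _ := by
              rw [two_mul k, pow_add (m : ℝ)]
              field_simp
      have h2 : r ^ (2 * k) ≤ (K ^ 2) ^ (2 * k) * q ^ (2 * k) := by
        rw [← (even_two_mul k).pow_abs q, ← mul_pow]
        exact habs k hrq
      have h3 : 0 ≤ (a ^ (2 * k) + b ^ (2 * k)) / (m : ℝ) ^ k := by positivity
      have h4 : 0 ≤ C * 2 ^ (2 * k) := by positivity
      have h5 : 0 ≤ (K ^ 2) ^ (2 * k) := by positivity
      rw [mul_assoc]
      gcongr
      nlinarith [mul_nonneg h4 (heven q k), mul_nonneg h5 h3]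

lemma measurable_feat {φ : ℝ → ℝ} (hφ : Measurable φ) (d : ℕ → ℕ) (L : ℕ) (ℓ : ℕ) :
    Measurable fun p : (Fin (d 0) → ℝ) × Wspace d L => feat φ d (extW p.2) p.1 ℓ := by
  induction ℓ with
  | zero => exact measurable_fst
  | succ ℓ ih =>
    have hW : ∀ i j, Measurable fun p : (Fin (d 0) → ℝ) × Wspace d L => extW p.2 ℓ i j := by
      intro i j
      by_cases h : ℓ < L
      · simp only [extW, h, dif_pos]
        fun_prop
      · simp only [extW, h, dif_neg, not_false_eq_true, Pi.zero_apply]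
        fun_prop
    refine measurable_pi_lambda _ fun i => hφ.comp (Measurable.div_const ?_ _)
    exact Finset.measurable_sum _ fun j _ => (hW i j).mul ((measurable_pi_apply j).comp ih)

lemma extW_update_self {d : ℕ → ℕ} {L : ℕ} (W : Wspace d L) (i : Fin L)
    (w : Fin (d ((i : ℕ) + 1)) → Fin (d (i : ℕ)) → ℝ) :
    extW (Function.update W i w) i = w := by
  simp [extW]

lemma extW_update_of_ne {d : ℕ → ℕ} {L : ℕ} (W : Wspace d L) (i : Fin L)
    (w : Fin (d ((i : ℕ) + 1)) → Fin (d (i : ℕ)) → ℝ) {ℓ : ℕ} (h : ℓ ≠ i) :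
    extW (Function.update W i w) ℓ = extW W ℓ := by
  by_cases hℓ : ℓ < L
  · simp only [extW, hℓ, dif_pos]
    exact Function.update_of_ne (fun e => h (by rw [← e])) _ _
  · simp [extW, hℓ]

lemma feat_update (φ : ℝ → ℝ) {d : ℕ → ℕ} {L : ℕ} (W : Wspace d L) (i : Fin L)
    (w : Fin (d ((i : ℕ) + 1)) → Fin (d (i : ℕ)) → ℝ) (x : Fin (d 0) → ℝ) {ℓ : ℕ}
    (h : ℓ ≤ i) :
    feat φ d (extW (Function.update W i w)) x ℓ = feat φ d (extW W) x ℓ := by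
  induction ℓ with
  | zero => rfl
  | succ ℓ ih =>
    rw [feat_succ, feat_succ, ih (by omega), extW_update_of_ne W i w (by omega)]

lemma dmin_le (d : ℕ → ℕ) {ℓ j : ℕ} (h : j ≤ ℓ) : dmin d ℓ ≤ d j :=
  Finset.inf'_le _ (Finset.mem_range.2 (by omega))

lemma dmin_succ_le (d : ℕ → ℕ) (ℓ : ℕ) : dmin d (ℓ + 1) ≤ dmin d ℓ :=
  Finset.le_inf' _ _ fun j hj => dmin_le d (by have := Finset.mem_range.1 hj; omega)

lemma one_le_dmin {d : ℕ → ℕ} {ℓ : ℕ} (h : ∀ j ≤ ℓ, 1 ≤ d j) : 1 ≤ dmin d ℓ :=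
  Finset.le_inf' _ _ fun j hj => h j (by have := Finset.mem_range.1 hj; omega)

lemma measurable_overlap (n : ℕ) :
    Measurable fun p : (Fin n → ℝ) × (Fin n → ℝ) => overlap p.1 p.2 := by
  unfold overlap
  fun_prop

lemma measurable_overlap_feat {φ : ℝ → ℝ} (hφ : Measurable φ) (d : ℕ → ℕ) (L ℓ : ℕ) :
    Measurable fun p : ((Fin (d 0) → ℝ) × (Fin (d 0) → ℝ)) × Wspace d L =>
      overlap (feat φ d (extW p.2) p.1.1 ℓ) (feat φ d (extW p.2) p.1.2 ℓ) := by
  have h := measurable_feat hφ d L ℓ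
  exact (measurable_overlap (d ℓ)).comp
    ((h.comp (by fun_prop : Measurable fun p : ((Fin (d 0) → ℝ) × (Fin (d 0) → ℝ)) × Wspace d L =>
      (p.1.1, p.2))).prodMk (h.comp (by fun_prop : Measurable
        fun p : ((Fin (d 0) → ℝ) × (Fin (d 0) → ℝ)) × Wspace d L => (p.1.2, p.2))))

lemma lintegral_ofReal_mul_add_div_le {E : Type*} [MeasurableSpace E] {μ : Measure E}
    {q a b : E → ℝ} (hqm : Measurable q) (ham : Measurable a) (hq0 : ∀ x, 0 ≤ q x)
    (ha0 : ∀ x, 0 ≤ a x) (hb0 : ∀ x, 0 ≤ b x) {C M Q A B : ℝ} (hC : 0 ≤ C) (hM : 0 ≤ M)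
    (hQ0 : 0 ≤ Q) (hA0 : 0 ≤ A) (hB0 : 0 ≤ B)
    (hQ : ∫⁻ x, ENNReal.ofReal (q x) ∂μ ≤ ENNReal.ofReal Q)
    (hA : ∫⁻ x, ENNReal.ofReal (a x) ∂μ ≤ ENNReal.ofReal A)
    (hB : ∫⁻ x, ENNReal.ofReal (b x) ∂μ ≤ ENNReal.ofReal B) :
    ∫⁻ x, ENNReal.ofReal (C * (q x + (a x + b x) / M)) ∂μ ≤
      ENNReal.ofReal (C * (Q + (A + B) / M)) := by
  have hMi : 0 ≤ M⁻¹ := inv_nonneg.2 hM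
  have e : ∀ {s t u : ℝ}, 0 ≤ s → 0 ≤ t → 0 ≤ u → ENNReal.ofReal (C * (s + (t + u) / M)) =
      ENNReal.ofReal C * (ENNReal.ofReal s +
        ENNReal.ofReal M⁻¹ * (ENNReal.ofReal t + ENNReal.ofReal u)) := by
    intro s t u hs ht hu
    rw [ENNReal.ofReal_mul hC, div_eq_inv_mul, ENNReal.ofReal_add hs (by positivity),
      ENNReal.ofReal_mul hMi, ENNReal.ofReal_add ht hu]
  simp_rw [e (hq0 _) (ha0 _) (hb0 _)]
  rw [e hQ0 hA0 hB0, lintegral_const_mul' _ _ ENNReal.ofReal_ne_top,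
    lintegral_add_left hqm.ennreal_ofReal, lintegral_const_mul' _ _ ENNReal.ofReal_ne_top,
    lintegral_add_left ham.ennreal_ofReal]
  gcongr

/-- For fixed inputs, the even moments of the overlap of two post-activations with respect to the
weights are controlled by the overlaps of the inputs. -/
lemma exists_feat_overlap_le {φ : ℝ → ℝ} {K : ℝ} (hK : 0 ≤ K)
    (hφ : ∀ x y, |φ x - φ y| ≤ K * |x - y|) (hodd : ∀ x, φ (-x) = -φ x)
    (hφm : Measurable φ) (k ℓ : ℕ) :
    ∃ C : ℝ, 0 ≤ C ∧ ∀ (d : ℕ → ℕ) (L : ℕ), ℓ ≤ L → (∀ j ≤ ℓ, 1 ≤ d j) →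
      ∀ x y : Fin (d 0) → ℝ,
      ∫⁻ W, ENNReal.ofReal
          (overlap (feat φ d (extW W) x ℓ) (feat φ d (extW W) y ℓ) ^ (2 * k)) ∂(Wmeasure d L) ≤
        ENNReal.ofReal (C * (overlap x y ^ (2 * k) +
          (overlap x x ^ (2 * k) + overlap y y ^ (2 * k)) / (dmin d ℓ : ℝ) ^ k)) := by
  have heven : ∀ s : ℝ, 0 ≤ s ^ (2 * k) := fun s => (even_two_mul k).pow_nonneg s
  induction ℓ with
  | zero =>
    refine ⟨1, zero_le_one, fun d L _ _ x y => ?_⟩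
    simp only [feat, lintegral_const, measure_univ, mul_one, one_mul]
    refine ENNReal.ofReal_le_ofReal (le_add_of_nonneg_right ?_)
    exact div_nonneg (add_nonneg (heven _) (heven _)) (by positivity)
  | succ ℓ ih =>
    obtain ⟨C₀, hC₀, h₀⟩ := ih
    obtain ⟨C₁, hC₁, h₁⟩ := exists_layer_overlap_le hK hφ hodd k
    refine ⟨C₁ * (4 * C₀), by positivity, fun d L hL hd x y => ?_⟩
    have hfm : ∀ (ℓ : ℕ) (x y : Fin (d 0) → ℝ), Measurable fun W : Wspace d L =>
        overlap (feat φ d (extW W) x ℓ) (feat φ d (extW W) y ℓ) ^ (2 * k) := fun ℓ x y =>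
      ((measurable_overlap_feat hφm d L ℓ).comp (measurable_prodMk_left (x := (x, y)))).pow_const _
    have hd' : ∀ j ≤ ℓ, 1 ≤ d j := fun j hj => hd j (by omega)
    have hD1 : (1 : ℝ) ≤ dmin d (ℓ + 1) := by exact_mod_cast one_le_dmin hd
    have hD2 : (dmin d (ℓ + 1) : ℝ) ≤ dmin d ℓ := by exact_mod_cast dmin_succ_le d ℓ
    have hD3 : (dmin d (ℓ + 1) : ℝ) ≤ d (ℓ + 1) := by exact_mod_cast dmin_le d le_rfl
    set i : Fin L := ⟨ℓ, hL⟩ with hi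
    have hself : ∀ z : Fin (d 0) → ℝ, ∫⁻ W, ENNReal.ofReal
        (overlap (feat φ d (extW W) z ℓ) (feat φ d (extW W) z ℓ) ^ (2 * k)) ∂(Wmeasure d L) ≤
        ENNReal.ofReal (3 * C₀ * overlap z z ^ (2 * k)) := fun z => by
      refine (h₀ d L (by omega) hd' z z).trans (ENNReal.ofReal_le_ofReal ?_)
      have h1 : (overlap z z ^ (2 * k) + overlap z z ^ (2 * k)) / (dmin d ℓ : ℝ) ^ k ≤
          overlap z z ^ (2 * k) + overlap z z ^ (2 * k) :=
        div_le_self (add_nonneg (heven _) (heven _)) (one_le_pow₀ (hD1.trans hD2))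
      nlinarith [mul_le_mul_of_nonneg_left h1 hC₀]
    have hstep : ∀ W : Wspace d L, ∫⁻ w, ENNReal.ofReal
        (overlap (feat φ d (extW (Function.update W i w)) x (ℓ + 1))
          (feat φ d (extW (Function.update W i w)) y (ℓ + 1)) ^ (2 * k))
          ∂(Measure.pi fun _ : Fin (d (ℓ + 1)) => stdGPi (d ℓ)) ≤
        ENNReal.ofReal (C₁ * (overlap (feat φ d (extW W) x ℓ) (feat φ d (extW W) y ℓ) ^ (2 * k) +
          (overlap (feat φ d (extW W) x ℓ) (feat φ d (extW W) x ℓ) ^ (2 * k) +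
            overlap (feat φ d (extW W) y ℓ) (feat φ d (extW W) y ℓ) ^ (2 * k)) /
              (d (ℓ + 1) : ℝ) ^ k)) := fun W => by
      refine le_trans (le_of_eq (lintegral_congr fun w => ?_))
        (h₁ (d ℓ) (d (ℓ + 1)) (hd _ le_rfl) _ _)
      have hw : extW (Function.update W i w) ℓ = w := extW_update_self W i w
      rw [feat_succ, feat_succ, hw, feat_update φ W i w x le_rfl, feat_update φ W i w y le_rfl]
    rw [Wmeasure, lintegral_pi_update _ i (hfm (ℓ + 1) x y).ennreal_ofReal]
    refine (lintegral_mono hstep).trans ?_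
    have hA := heven (overlap x x)
    have hB := heven (overlap y y)
    have hQ := heven (overlap x y)
    refine (lintegral_ofReal_mul_add_div_le (hfm ℓ x y) (hfm ℓ x x) (fun _ => heven _)
      (fun _ => heven _) (fun _ => heven _) hC₁ (by positivity) (by positivity) (by positivity)
      (by positivity) (h₀ d L (by omega) hd' x y) (hself x) (hself y)).trans
      (ENNReal.ofReal_le_ofReal ?_)
    rw [mul_assoc C₁]
    refine mul_le_mul_of_nonneg_left ?_ hC₁
    set A := overlap x x ^ (2 * k)
    set B := overlap y y ^ (2 * k)
    set Q := overlap x y ^ (2 * k)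
    set D : ℝ := ((dmin d (ℓ + 1) : ℕ) : ℝ)
    have hD0 : 0 < D := by linarith
    calc _ ≤ C₀ * (Q + (A + B) / D ^ k) + (3 * C₀ * A + 3 * C₀ * B) / D ^ k := by
          gcongr
      _ = C₀ * Q + 4 * C₀ * ((A + B) / D ^ k) := by ring
      _ ≤ _ := by nlinarith [mul_nonneg hC₀ hQ]

lemma lintegral_overlap_self_pow_le {d : ℕ} (hd : 1 ≤ d) (p : ℕ) :
    ∫⁻ u, ENNReal.ofReal (overlap u u ^ p) ∂(stdGPi d) ≤
      ENNReal.ofReal (gaussianMoment (2 * p)) := by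
  have hd0 : (0 : ℝ) < d := by exact_mod_cast hd
  have hint : ∀ j : Fin d, Integrable (fun u : Fin d → ℝ => (d : ℝ)⁻¹ * u j ^ (2 * p))
      (stdGPi d) := fun j =>
    ((hasMoments_stdG.comp (measurePreserving_eval (fun _ : Fin d => stdG) j)).integrable_pow
      _).const_mul _
  have hpt : ∀ u : Fin d → ℝ, overlap u u ^ p ≤ ∑ j, (d : ℝ)⁻¹ * u j ^ (2 * p) := fun u => by
    have h := Real.pow_arith_mean_le_arith_mean_pow Finset.univ (fun _ : Fin d => (d : ℝ)⁻¹)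
      (fun j => u j * u j) (fun _ _ => by positivity) (by simp [hd0.ne'])
      (fun j _ => mul_self_nonneg _) p
    rw [← Finset.mul_sum, ← div_eq_inv_mul] at h
    simpa only [overlap, ← sq, ← pow_mul] using h
  calc _ ≤ ∫⁻ u, ENNReal.ofReal (∑ j, (d : ℝ)⁻¹ * u j ^ (2 * p)) ∂(stdGPi d) :=
        lintegral_mono fun u => ENNReal.ofReal_le_ofReal (hpt u)
    _ = ENNReal.ofReal (∫ u, ∑ j, (d : ℝ)⁻¹ * u j ^ (2 * p) ∂(stdGPi d)) :=
        (ofReal_integral_eq_lintegral_ofReal (integrable_finsetSum _ fun j _ => hint j)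
          (ae_of_all _ fun u => Finset.sum_nonneg fun j _ =>
            mul_nonneg (by positivity) ((even_two_mul p).pow_nonneg _))).symm
    _ = _ := by
      rw [integral_finsetSum _ fun j _ => hint j]
      have h : ∀ j : Fin d, ∫ u : Fin d → ℝ, u j ^ (2 * p) ∂(stdGPi d) = gaussianMoment (2 * p) :=
        fun j => integral_comp_eval (μ := fun _ : Fin d => stdG) (f := fun z => z ^ (2 * p))
          (by fun_prop)
      simp_rw [integral_const_mul, h]
      simp [hd0.ne']

lemma lintegral_overlap_pow_eq {d : ℕ} (hd : 1 ≤ d) (u : Fin d → ℝ) (k : ℕ) :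
    ∫⁻ v, ENNReal.ofReal (overlap u v ^ (2 * k)) ∂(stdGPi d) =
      ENNReal.ofReal (gaussianMoment (2 * k) / d ^ k) * ENNReal.ofReal (overlap u u ^ k) := by
  have hd0 : (0 : ℝ) < d := by exact_mod_cast hd
  have e : ∀ v : Fin d → ℝ, overlap u v ^ (2 * k) =
      (∑ j, v j * u j) ^ (2 * k) / (d : ℝ) ^ (2 * k) := fun v => by
    rw [overlap, div_pow]
    simp_rw [mul_comm (u _)]
  simp_rw [e]
  rw [← ofReal_integral_eq_lintegral_ofReal
    (((hasMoments_dot u).integrable_pow _).div_const _)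
    (ae_of_all _ fun v => div_nonneg ((even_two_mul k).pow_nonneg _) (by positivity)),
    integral_div, integral_dot_pow, ← ENNReal.ofReal_mul
    (div_nonneg (gaussianMoment_even_nonneg k) (by positivity))]
  congr 1
  simp_rw [overlap, div_pow, ← sq, two_mul k, pow_add (d : ℝ)]
  field_simp

lemma lintegral_input_overlap_pow_le {d : ℕ} (hd : 1 ≤ d) (k : ℕ) {n : ℕ} {μ ν : Fin n}
    (h : μ ≠ ν) :
    ∫⁻ x, ENNReal.ofReal (overlap (x μ) (x ν) ^ (2 * k))
        ∂(Measure.pi fun _ : Fin n => stdGPi d) ≤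
      ENNReal.ofReal (gaussianMoment (2 * k) ^ 2 / d ^ k) := by
  have hm : Measurable fun x : Fin n → Fin d → ℝ =>
      ENNReal.ofReal (overlap (x μ) (x ν) ^ (2 * k)) := by
    unfold overlap; fun_prop
  have hm2 : Measurable fun u : Fin d → ℝ => ENNReal.ofReal (overlap u u ^ k) := by
    unfold overlap; fun_prop
  have hG := gaussianMoment_even_nonneg k
  rw [lintegral_pi_update _ ν hm]
  simp only [Function.update_self, Function.update_of_ne h, lintegral_overlap_pow_eq hd]
  rw [lintegral_const_mul' _ _ ENNReal.ofReal_ne_top,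
    (measurePreserving_eval (fun _ : Fin n => stdGPi d) μ).lintegral_comp hm2]
  refine (mul_le_mul_right (lintegral_overlap_self_pow_le hd k) _).trans_eq ?_
  rw [← ENNReal.ofReal_mul (by positivity)]
  congr 1
  ring

lemma lintegral_input_overlap_self_pow_le {d : ℕ} (hd : 1 ≤ d) (p : ℕ) {n : ℕ} (μ : Fin n) :
    ∫⁻ x, ENNReal.ofReal (overlap (x μ) (x μ) ^ p)
        ∂(Measure.pi fun _ : Fin n => stdGPi d) ≤ ENNReal.ofReal (gaussianMoment (2 * p)) := by
  have hm : Measurable fun u : Fin d → ℝ => ENNReal.ofReal (overlap u u ^ p) := by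
    unfold overlap; fun_prop
  rw [(measurePreserving_eval (fun _ : Fin n => stdGPi d) μ).lintegral_comp hm]
  exact lintegral_overlap_self_pow_le hd p

/-- A bound of order `D⁻ᵏ` on the `2k`-th moment gives one of order `D^(-k/2)` on the `k`-th
absolute moment. -/
lemma integral_abs_pow_le_div_rpow {E : Type*} [MeasurableSpace E] {P : Measure E}
    [IsProbabilityMeasure P] {Q : E → ℝ} (hQ : Measurable Q) {k : ℕ} {M D : ℝ} (hM : 0 ≤ M)
    (hD : 0 < D)
    (h : ∫⁻ ω, ENNReal.ofReal (Q ω ^ (2 * k)) ∂P ≤ ENNReal.ofReal (M / D ^ k)) :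
    ∫ ω, |Q ω| ^ k ∂P ≤ (M + 1) / D ^ ((k : ℝ) / 2) := by
  have ht0 : 0 < D ^ ((k : ℝ) / 2) := Real.rpow_pos_of_pos hD _
  have ht2 : D ^ ((k : ℝ) / 2) * D ^ ((k : ℝ) / 2) = D ^ k := by
    rw [← Real.rpow_add hD, add_halves, Real.rpow_natCast]
  generalize D ^ ((k : ℝ) / 2) = t at ht0 ht2 ⊢
  have heven : ∀ s : ℝ, 0 ≤ s ^ (2 * k) := fun s => (even_two_mul k).pow_nonneg s
  have hpt : ∀ s : ℝ, |s| ^ k ≤ t * s ^ (2 * k) + 1 / t := fun s => by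
    have h1 : s ^ (2 * k) = (|s| ^ k) ^ 2 := by
      rw [← pow_mul', (even_two_mul k).pow_abs]
    have h2 : t * s ^ (2 * k) + 1 / t - |s| ^ k =
        ((t * |s| ^ k - 1) ^ 2 + t * |s| ^ k) / t := by
      rw [h1]; field_simp; ring
    have h3 : 0 ≤ ((t * |s| ^ k - 1) ^ 2 + t * |s| ^ k) / t := by positivity
    linarith
  rw [integral_eq_lintegral_of_nonneg_ae (ae_of_all _ fun ω => pow_nonneg (abs_nonneg _) _)
    (by fun_prop : Measurable fun ω => |Q ω| ^ k).aestronglyMeasurable]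
  refine ENNReal.toReal_le_of_le_ofReal (by positivity) ?_
  calc _ ≤ ∫⁻ ω, (ENNReal.ofReal t * ENNReal.ofReal (Q ω ^ (2 * k)) + ENNReal.ofReal (1 / t)) ∂P :=
        lintegral_mono fun ω => by
          rw [← ENNReal.ofReal_mul ht0.le, ← ENNReal.ofReal_add
            (mul_nonneg ht0.le (heven _)) (by positivity)]
          exact ENNReal.ofReal_le_ofReal (hpt _)
    _ = ENNReal.ofReal t * ∫⁻ ω, ENNReal.ofReal (Q ω ^ (2 * k)) ∂P + ENNReal.ofReal (1 / t) := by
        rw [lintegral_add_right _ measurable_const,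
          lintegral_const_mul' _ _ ENNReal.ofReal_ne_top]
        simp
    _ ≤ ENNReal.ofReal t * ENNReal.ofReal (M / D ^ k) +
          ENNReal.ofReal (1 / t) := by gcongr
    _ = _ := by
        rw [← ENNReal.ofReal_mul ht0.le, ← ENNReal.ofReal_add (by positivity) (by positivity),
          ← ht2]
        congr 1
        field_simp

lemma measurable_comp_eval_pair {X Y Z ι : Type*} [MeasurableSpace X] [MeasurableSpace Y]
    [MeasurableSpace Z] {F : (X × X) × Y → Z} (h : Measurable F) (μ ν : ι) :
    Measurable fun ω : (ι → X) × Y => F ((ω.1 μ, ω.1 ν), ω.2) :=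
  h.comp (by fun_prop)

lemma lintegral_comp_eval_pair_le {X Y ι : Type*} [MeasurableSpace X] [MeasurableSpace Y]
    {P : Measure (ι → X)} {κ : Measure Y} [SFinite κ] {F : (X × X) × Y → ℝ} (hF : Measurable F)
    {B : X → X → ENNReal} (p : ℕ)
    (h : ∀ x y, ∫⁻ w, ENNReal.ofReal (F ((x, y), w) ^ p) ∂κ ≤ B x y) (μ ν : ι) :
    ∫⁻ ω, ENNReal.ofReal (F ((ω.1 μ, ω.1 ν), ω.2) ^ p) ∂(P.prod κ) ≤
      ∫⁻ x, B (x μ) (x ν) ∂P := by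
  rw [lintegral_prod _
    ((measurable_comp_eval_pair hF μ ν).pow_const p).ennreal_ofReal.aemeasurable]
  exact lintegral_mono fun x => h (x μ) (x ν)

lemma measurable_network_overlap {φ : ℝ → ℝ} (hφ : Measurable φ) (d : ℕ → ℕ) (L ℓ : ℕ) {n : ℕ}
    (μ ν : Fin n) :
    Measurable fun ω : (Fin n → Fin (d 0) → ℝ) × Wspace d L =>
      overlap (feat φ d (extW ω.2) (ω.1 μ) ℓ) (feat φ d (extW ω.2) (ω.1 ν) ℓ) :=
  measurable_comp_eval_pair (measurable_overlap_feat hφ d L ℓ) μ ν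

/-- The even moments of the overlap of two post-activations with independent Gaussian inputs. -/
lemma exists_network_overlap_le {φ : ℝ → ℝ} {K : ℝ} (hK : 0 ≤ K)
    (hφ : ∀ x y, |φ x - φ y| ≤ K * |x - y|) (hodd : ∀ x, φ (-x) = -φ x)
    (hφm : Measurable φ) (k ℓ : ℕ) :
    ∃ M : ℝ, 0 ≤ M ∧ ∀ (d : ℕ → ℕ) (L : ℕ), ℓ ≤ L → (∀ j ≤ ℓ, 1 ≤ d j) →
      ∀ (n : ℕ) (μ ν : Fin n), μ ≠ ν →
      ∫⁻ ω, ENNReal.ofReal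
          (overlap (feat φ d (extW ω.2) (ω.1 μ) ℓ) (feat φ d (extW ω.2) (ω.1 ν) ℓ) ^ (2 * k))
          ∂((Measure.pi fun _ : Fin n => stdGPi (d 0)).prod (Wmeasure d L)) ≤
        ENNReal.ofReal (M / (dmin d ℓ : ℝ) ^ k) := by
  obtain ⟨C, hC, hCb⟩ := exists_feat_overlap_le hK hφ hodd hφm k ℓ
  have hH0 : 0 ≤ gaussianMoment (2 * (2 * k)) := gaussianMoment_even_nonneg _
  refine ⟨C * (gaussianMoment (2 * k) ^ 2 +
    (gaussianMoment (2 * (2 * k)) + gaussianMoment (2 * (2 * k)))), by positivity,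
    fun d L hL hd n μ ν hμν => ?_⟩
  have hd0 : 1 ≤ d 0 := hd 0 (Nat.zero_le _)
  have heven : ∀ s : ℝ, 0 ≤ s ^ (2 * k) := fun s => (even_two_mul k).pow_nonneg s
  have hm : ∀ μ ν : Fin n, Measurable fun x : Fin n → Fin (d 0) → ℝ =>
      overlap (x μ) (x ν) ^ (2 * k) := fun μ ν => by
    unfold overlap; fun_prop
  refine (lintegral_comp_eval_pair_le (measurable_overlap_feat hφm d L ℓ) (2 * k)
    (fun x y => hCb d L hL hd x y) μ ν).trans ?_
  refine (lintegral_ofReal_mul_add_div_le (hm μ ν) (hm μ μ) (fun _ => heven _)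
    (fun _ => heven _) (fun _ => heven _) hC (by positivity) (by positivity) hH0 hH0
    (lintegral_input_overlap_pow_le hd0 k hμν)
    (lintegral_input_overlap_self_pow_le hd0 (2 * k) μ)
    (lintegral_input_overlap_self_pow_le hd0 (2 * k) ν)).trans (ENNReal.ofReal_le_ofReal ?_)
  have hDd : (dmin d ℓ : ℝ) ≤ d 0 := Nat.cast_le.2 (dmin_le d (Nat.zero_le ℓ))
  have hD0 : (0 : ℝ) < dmin d ℓ := Nat.cast_pos.2 (one_le_dmin hd)
  generalize (dmin d ℓ : ℝ) = D at hDd hD0 ⊢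
  rw [mul_div_assoc, add_div (gaussianMoment (2 * k) ^ 2)]
  gcongr

/-- **Lemma C.2 (Quasi-orthogonality propagation).** For every `ℓ ∈ {0, …, L}`, every
positive integer `k` and all `μ ≠ ν`, `E|X_μ^{(ℓ)}·X_ν^{(ℓ)}/d_ℓ|^k ≤ C_k/d_{[0:ℓ]}^{k/2}`
with `C_k` depending only on `k`, `ℓ` and `φ`. -/
theorem quasi_orthogonality_propagation
    (L : ℕ) (hL : 1 ≤ L) (φ : ℝ → ℝ)
    (hφC2 : ContDiff ℝ 2 φ) (hφodd : ∀ x, φ (-x) = -φ x)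
    (hφbd : ∃ K, ∀ x, |deriv φ x| ≤ K ∧ |deriv (deriv φ) x| ≤ K)
    (k : ℕ) (hk : 1 ≤ k) (ℓ : ℕ) (hℓ : ℓ ≤ L) :
    ∃ C > 0, ∀ d : ℕ → ℕ, (∀ j ≤ L, 1 ≤ d j) → ∀ n : ℕ, ∀ μ ν : Fin n, μ ≠ ν →
      ∫ ω : (Fin n → Fin (d 0) → ℝ) × Wspace d L,
          |(∑ i : Fin (d ℓ),
              feat φ d (extW ω.2) (ω.1 μ) ℓ i * feat φ d (extW ω.2) (ω.1 ν) ℓ i) /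
            (d ℓ : ℝ)| ^ k
        ∂((Measure.pi fun _ : Fin n => stdGPi (d 0)).prod (Wmeasure d L)) ≤
      C / (dmin d ℓ : ℝ) ^ ((k : ℝ) / 2) := by
  obtain ⟨K, hKb⟩ := hφbd
  have hK : 0 ≤ K := (abs_nonneg _).trans (hKb 0).1
  have hLip : ∀ x y, |φ x - φ y| ≤ K * |x - y| := fun x y => by
    have h : LipschitzWith K.toNNReal φ :=
      lipschitzWith_of_nnnorm_deriv_le (hφC2.differentiable (by norm_num)) fun x => by
        rw [← NNReal.coe_le_coe, coe_nnnorm, Real.coe_toNNReal K hK]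
        exact (hKb x).1
    simpa [Real.dist_eq, Real.coe_toNNReal K hK] using h.dist_le_mul x y
  have hφm : Measurable φ := hφC2.continuous.measurable
  obtain ⟨M, hM, hMb⟩ := exists_network_overlap_le hK hLip hφodd hφm k ℓ
  refine ⟨M + 1, by positivity, fun d hd n μ ν hμν => ?_⟩
  have hdℓ : ∀ j ≤ ℓ, 1 ≤ d j := fun j hj => hd j (hj.trans hℓ)
  exact integral_abs_pow_le_div_rpow (measurable_network_overlap hφm d L ℓ μ ν) hM
    (Nat.cast_pos.2 (one_le_dmin hdℓ)) (hMb d L hℓ hdℓ n μ ν hμν)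

end
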